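/- (Proposition 3) For all x, y ∈ X, under the modified Lindbladian with jump operator L' = Π⁻ ⊗ σ⁻ + (I − Π⁻) ⊗ σ⁺ and ancilla initialized in |+⟩ := (|0⟩ + |1⟩)/√2, the evolution converges as t → ∞: E'_t(|x⟩⟨y| ⊗ |+⟩⟨+|) → |x⟩⟨y| ⊗ |C(x)⟩⟨C(y)|. -/

import Mathlib

open Matrix Filter
open scoped Kronecker Topology

attribute [local instance] Matrix.normedAddCommGroup Matrix.normedSpace

noncomputable section

/-- The computational basis of `n` qubits, `X = {0,1}ⁿ`. -/
abbrev QubitBasis (n : ℕ) := Fin n → Bool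

/-- Evaluation of the 3-literal clause with indices `i₁ i₂ i₃` and bits `b₁ b₂ b₃`:
`C(x) = ¬(x i₁ = b₁ ∧ x i₂ = b₂ ∧ x i₃ = b₃)`. -/
def clauseEval {n : ℕ} (i₁ i₂ i₃ : Fin n) (b₁ b₂ b₃ : Bool) (x : QubitBasis n) : Bool :=
  ! (decide (x i₁ = b₁) && decide (x i₂ = b₂) && decide (x i₃ = b₃))

/-- The modified Lindblad operator `L' = Π⁻ ⊗ σ⁻ + (I − Π⁻) ⊗ σ⁺`:
`L'((x,a),(y,b)) = 1` iff `x = y`, `a = C(x)` and `b = ¬C(x)`. -/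
def jumpOp' {n : ℕ} (C : QubitBasis n → Bool) :
    Matrix (QubitBasis n × Bool) (QubitBasis n × Bool) ℂ :=
  Matrix.of fun p q =>
    if p.1 = q.1 ∧ p.2 = C p.1 ∧ q.2 = !C p.1 then 1 else 0

/-- The Lindbladian `ℒ(ρ) = γ (L ρ L† − (1/2)(L†L ρ + ρ L†L))` as a linear endomorphism
of the matrix space. -/
def lindbladian {d : Type*} [Fintype d] [DecidableEq d] (γ : ℝ) (L : Matrix d d ℂ) :
    Matrix d d ℂ →ₗ[ℂ] Matrix d d ℂ :=
  (γ : ℂ) • ((LinearMap.mulRight ℂ Lᴴ).comp (LinearMap.mulLeft ℂ L)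
    - (1 / 2 : ℂ) • (LinearMap.mulLeft ℂ (Lᴴ * L) + LinearMap.mulRight ℂ (Lᴴ * L)))

/-- The evolution `E'_t = exp(t·ℒ')`, the exponential of the endomorphism `ℒ'`. -/
def evol {d : Type*} [Fintype d] [DecidableEq d]
    (L : Matrix d d ℂ →ₗ[ℂ] Matrix d d ℂ) (t : ℝ) :
    Matrix d d ℂ →L[ℂ] Matrix d d ℂ :=
  haveI : IsTopologicalRing (Matrix d d ℂ →L[ℂ] Matrix d d ℂ) := by
    have h : ∀ (V : Type _) [NormedAddCommGroup V] [NormedSpace ℂ V],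
        IsTopologicalRing (V →L[ℂ] V) := fun _ _ _ => inferInstance
    exact h (Matrix d d ℂ)
  NormedSpace.exp ((t : ℂ) • LinearMap.toContinuousLinearMap L)

theorem exp_apply_eigen {V : Type*} [NormedAddCommGroup V] [NormedSpace ℂ V] [CompleteSpace V]
    (A : V →L[ℂ] V) (μ : ℂ) (v : V) (h : A v = μ • v) (t : ℝ) :
    (NormedSpace.exp ((t : ℂ) • A)) v = Complex.exp (t * μ) • v := by
  have h1 := NormedSpace.exp_series_hasSum_exp' (𝕂 := ℂ) ((t : ℂ) • A)
  have h2 := (ContinuousLinearMap.apply ℂ V v).hasSum h1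
  have h3 := (NormedSpace.exp_series_hasSum_exp' (𝕂 := ℂ) ((t : ℂ) * μ)).smul_const v
  rw [← Complex.exp_eq_exp_ℂ] at h3
  have hp : ∀ k : ℕ, (((t : ℂ) • A) ^ k) v = ((t : ℂ) * μ) ^ k • v := by
    intro k
    induction k with
    | zero => simp
    | succ k ih =>
      rw [pow_succ', mul_apply_eq_comp, ih, map_smul, ContinuousLinearMap.smul_apply, h,
        smul_smul, smul_smul, pow_succ, mul_assoc]
  refine h2.unique ?_
  convert h3 using 2 with k
  rw [ContinuousLinearMap.apply_apply, ContinuousLinearMap.smul_apply, hp, smul_smul, smul_eq_mul]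

theorem evol_apply_eigen {d : Type*} [Fintype d] [DecidableEq d]
    (L : Matrix d d ℂ →ₗ[ℂ] Matrix d d ℂ) (μ : ℂ) (v : Matrix d d ℂ) (h : L v = μ • v) (t : ℝ) :
    evol L t v = Complex.exp (t * μ) • v :=
  exp_apply_eigen (V := Matrix d d ℂ) (LinearMap.toContinuousLinearMap L) μ v h t

theorem jump_entry {n : ℕ} (C : QubitBasis n → Bool) (p q : QubitBasis n × Bool) :
    jumpOp' C p q = if p = (q.1, C q.1) ∧ q = (q.1, !C q.1) then 1 else 0 := by
  obtain ⟨x, a⟩ := p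
  obtain ⟨y, b⟩ := q
  simp only [jumpOp', Matrix.of_apply, Prod.mk.injEq]
  by_cases hxy : x = y
  · subst hxy; simp
  · simp [hxy]

theorem jump_mul_single {n : ℕ} (C : QubitBasis n → Bool) (x : QubitBasis n)
    (q : QubitBasis n × Bool) (a : Bool) :
    jumpOp' C * Matrix.single (x, a) q (1 : ℂ) =
      if a = C x then 0 else Matrix.single (x, C x) q 1 := by
  ext p r
  by_cases hr : r = q
  · subst hr
    rw [Matrix.mul_single_apply_same, jump_entry]
    by_cases ha : a = C x
    · simp [ha]
    · have : a = !C x := by cases a <;> cases h : C x <;> simp_all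
      simp [this, Matrix.single_apply, eq_comm]
  · rw [Matrix.mul_single_apply_of_ne _ _ _ _ _ hr]
    split_ifs
    · simp
    · simp [Matrix.single_apply, Ne.symm hr]

theorem jumpH_mul_single {n : ℕ} (C : QubitBasis n → Bool) (x : QubitBasis n)
    (q : QubitBasis n × Bool) :
    (jumpOp' C)ᴴ * Matrix.single (x, C x) q (1 : ℂ) = Matrix.single (x, !C x) q 1 := by
  ext p r
  by_cases hr : r = q
  · subst hr
    rw [Matrix.mul_single_apply_same, Matrix.conjTranspose_apply]
    obtain ⟨z, b⟩ := p
    simp only [jumpOp', Matrix.of_apply, Matrix.single_apply, Prod.mk.injEq]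
    by_cases hz : x = z
    · subst hz; simp [eq_comm, apply_ite]
    · simp [hz]
  · rw [Matrix.mul_single_apply_of_ne _ _ _ _ _ hr]
    simp [Matrix.single_apply, Ne.symm hr]

theorem num_mul_single {n : ℕ} (C : QubitBasis n → Bool) (x : QubitBasis n)
    (q : QubitBasis n × Bool) (a : Bool) :
    (jumpOp' C)ᴴ * jumpOp' C * Matrix.single (x, a) q (1 : ℂ) =
      if a = C x then 0 else Matrix.single (x, a) q 1 := by
  rw [Matrix.mul_assoc, jump_mul_single]
  split_ifs with ha
  · simp
  · have : a = !C x := by cases a <;> cases h : C x <;> simp_all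
    rw [jumpH_mul_single, this]

theorem single_mul_jumpH {n : ℕ} (C : QubitBasis n → Bool) (x : QubitBasis n)
    (q : QubitBasis n × Bool) (a : Bool) :
    Matrix.single q (x, a) (1 : ℂ) * (jumpOp' C)ᴴ =
      if a = C x then 0 else Matrix.single q (x, C x) 1 := by
  have := congrArg Matrix.conjTranspose (jump_mul_single C x q a)
  simpa [apply_ite Matrix.conjTranspose] using this

theorem single_mul_num {n : ℕ} (C : QubitBasis n → Bool) (x : QubitBasis n)
    (q : QubitBasis n × Bool) (a : Bool) :
    Matrix.single q (x, a) (1 : ℂ) * ((jumpOp' C)ᴴ * jumpOp' C) =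
      if a = C x then 0 else Matrix.single q (x, a) 1 := by
  have := congrArg Matrix.conjTranspose (num_mul_single C x q a)
  simpa [apply_ite Matrix.conjTranspose] using this

theorem lind_single {n : ℕ} (γ : ℝ) (C : QubitBasis n → Bool) (x y : QubitBasis n) (a b : Bool) :
    lindbladian γ (jumpOp' C) (Matrix.single (x, a) (y, b) 1) =
      (γ : ℂ) • ((if a = C x then 0 else if b = C y then 0 else Matrix.single (x, C x) (y, C y) 1)
        - (1 / 2 : ℂ) • ((if a = C x then 0 else Matrix.single (x, a) (y, b) 1)
          + (if b = C y then 0 else Matrix.single (x, a) (y, b) 1))) := by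
  simp only [lindbladian, LinearMap.smul_apply, LinearMap.sub_apply, LinearMap.comp_apply,
    LinearMap.add_apply, LinearMap.mulLeft_apply, LinearMap.mulRight_apply]
  rw [jump_mul_single, num_mul_single, single_mul_num]
  by_cases ha : a = C x
  · simp [ha]
  · simp only [ha, if_false]
    rw [single_mul_jumpH]

theorem tendsto_decay (c : ℝ) (hc : c < 0) :
    Tendsto (fun t : ℝ => Complex.exp (t * (c : ℂ))) atTop (𝓝 0) := by
  rw [Complex.tendsto_exp_nhds_zero_iff]
  have : (fun t : ℝ => ((t : ℂ) * (c : ℂ)).re) = fun t => t * c := by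
    ext t; simp
  rw [this]
  exact tendsto_id.atTop_mul_const_of_neg hc

/-- Proposition 3: with the modified jump operator and the ancilla
initialized in `|+⟩`, `E'_t(|x⟩⟨y| ⊗ |+⟩⟨+|) → |x⟩⟨y| ⊗ |C(x)⟩⟨C(y)|` as `t → ∞`. -/
theorem evol'_plus_limit {n : ℕ} (hn : 1 ≤ n)
    (i₁ i₂ i₃ : Fin n) (h₁₂ : i₁ ≠ i₂) (h₁₃ : i₁ ≠ i₃) (h₂₃ : i₂ ≠ i₃)
    (b₁ b₂ b₃ : Bool) (γ : ℝ) (hγ : 0 < γ)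
    (C : QubitBasis n → Bool) (hC : C = clauseEval i₁ i₂ i₃ b₁ b₂ b₃)
    (x y : QubitBasis n) :
    Tendsto
      (fun t : ℝ => evol (lindbladian γ (jumpOp' C)) t
        (Matrix.single x y (1 : ℂ) ⊗ₖ Matrix.of fun _ _ : Bool => (1 / 2 : ℂ)))
      atTop
      (𝓝 (Matrix.single (x, C x) (y, C y) (1 : ℂ))) := by
  have hG := evol_apply_eigen (lindbladian γ (jumpOp' C)) 0
    (Matrix.single (x, C x) (y, C y) (1 : ℂ)) (by rw [lind_single]; simp)
  have hB := evol_apply_eigen (lindbladian γ (jumpOp' C)) ((-γ : ℝ) : ℂ)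
    (Matrix.single (x, !C x) (y, !C y) (1 : ℂ) - Matrix.single (x, C x) (y, C y) (1 : ℂ)) (by
      rw [map_sub, lind_single, lind_single]
      simp only [Bool.not_eq_eq_eq_not, Bool.eq_not_self, Bool.not_eq_self, if_true, if_false]
      push_cast
      module)
  have hM := evol_apply_eigen (lindbladian γ (jumpOp' C)) ((-γ / 2 : ℝ) : ℂ)
    (Matrix.single (x, C x) (y, !C y) (1 : ℂ)) (by
      rw [lind_single]
      simp only [Bool.not_eq_self, if_true, if_false]
      push_cast
      module)
  have hN := evol_apply_eigen (lindbladian γ (jumpOp' C)) ((-γ / 2 : ℝ) : ℂ)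
    (Matrix.single (x, !C x) (y, C y) (1 : ℂ)) (by
      rw [lind_single]
      simp only [Bool.not_eq_self, if_true, if_false]
      push_cast
      module)
  have hρ : (Matrix.single x y (1 : ℂ) ⊗ₖ Matrix.of fun _ _ : Bool => (1 / 2 : ℂ)) =
      Matrix.single (x, C x) (y, C y) (1 : ℂ)
      + (1 / 2 : ℂ) • (Matrix.single (x, !C x) (y, !C y) (1 : ℂ)
          - Matrix.single (x, C x) (y, C y) (1 : ℂ))
      + (1 / 2 : ℂ) • Matrix.single (x, C x) (y, !C y) (1 : ℂ)
      + (1 / 2 : ℂ) • Matrix.single (x, !C x) (y, C y) (1 : ℂ) := by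
    ext ⟨p, a⟩ ⟨q, b⟩
    simp only [Matrix.kroneckerMap_apply, Matrix.single_apply, Matrix.of_apply, Matrix.add_apply,
      Matrix.sub_apply, Matrix.smul_apply, Prod.mk.injEq]
    by_cases hx : x = p <;> by_cases hy : y = q <;> simp [hx, hy]
    cases a <;> cases b <;> cases C p <;> cases C q <;> norm_num
  rw [hρ]
  simp only [map_add, map_smul, hG, hB, hM, hN]
  have d1 := tendsto_decay (-γ) (by linarith)
  have d2 := tendsto_decay (-γ / 2) (by linarith)
  have key := (((tendsto_const_nhds (x := Matrix.single (x, C x) (y, C y) (1 : ℂ))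
      (f := (atTop : Filter ℝ))).add
    ((d1.smul_const (Matrix.single (x, !C x) (y, !C y) (1 : ℂ)
          - Matrix.single (x, C x) (y, C y) (1 : ℂ))).const_smul (1 / 2 : ℂ))).add
    ((d2.smul_const (Matrix.single (x, C x) (y, !C y) (1 : ℂ))).const_smul (1 / 2 : ℂ))).add
    ((d2.smul_const (Matrix.single (x, !C x) (y, C y) (1 : ℂ))).const_smul (1 / 2 : ℂ))
  simpa using key
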